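/- Let M be a sober MT-algebra. Then M is stably locally compact (i.e., locally compact and the meet of any two compact saturated elements of M is compact saturated) if and only if O(M) is a stably continuous frame. -/

import Mathlib

/-- An MT-algebra: a complete Boolean algebra with an interior operator. -/
structure MTAlg (M : Type*) [CompleteBooleanAlgebra M] where
  box : M → M
  box_top : box ⊤ = ⊤
  box_inf : ∀ a b : M, box (a ⊓ b) = box a ⊓ box b
  box_le : ∀ a : M, box a ≤ a
  box_idem : ∀ a : M, box a ≤ box (box a)

namespace MTAlg

variable {M : Type*} [CompleteBooleanAlgebra M] (T : MTAlg M)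

/-- The closure (dual) operator. -/
def dia (a : M) : M := (T.box aᶜ)ᶜ

/-- Open elements. -/
def IsOpenElem (a : M) : Prop := T.box a = a

/-- Closed elements. -/
def IsClosedElem (a : M) : Prop := T.dia a = a

/-- Saturated elements: meets of open elements. -/
def IsSaturatedElem (a : M) : Prop :=
  ∃ S : Set M, (∀ s ∈ S, T.IsOpenElem s) ∧ a = sInf S

/-- Weakly locally closed elements: meets of a saturated and a closed element. -/
def IsWLC (a : M) : Prop :=
  ∃ s c : M, T.IsSaturatedElem s ∧ T.IsClosedElem c ∧ a = s ⊓ c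

/-- T0-algebras: every element is a join of weakly locally closed elements. -/
def IsT0 : Prop :=
  ∀ a : M, ∃ S : Set M, (∀ b ∈ S, T.IsWLC b) ∧ a = sSup S

/-- T1-algebras: every element is a join of closed elements. -/
def IsT1 : Prop :=
  ∀ a : M, ∃ S : Set M, (∀ b ∈ S, T.IsClosedElem b) ∧ a = sSup S

/-- Join-irreducible elements of the lattice of closed elements. -/
def JoinIrredClosed (p : M) : Prop :=
  T.IsClosedElem p ∧ p ≠ ⊥ ∧
    ∀ a b : M, T.IsClosedElem a → T.IsClosedElem b → p = a ⊔ b → p = a ∨ p = b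

/-- Sober MT-algebras. -/
def Sober : Prop :=
  T.IsT0 ∧ ∀ p : M, T.JoinIrredClosed p → ∃ x : M, IsAtom x ∧ p = T.dia x

/-- Filters of the underlying lattice. -/
def IsFilter (F : Set M) : Prop :=
  ⊤ ∈ F ∧ (∀ a b : M, a ∈ F → a ≤ b → b ∈ F) ∧ (∀ a b : M, a ∈ F → b ∈ F → a ⊓ b ∈ F)

/-- Open filters. -/
def IsOpenFilter (F : Set M) : Prop :=
  IsFilter F ∧ ∀ a ∈ F, T.box a ∈ F

/-- Scott-open filters. -/
def IsScottOpenFilter (F : Set M) : Prop :=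
  T.IsOpenFilter F ∧
    ∀ S : Set M, (∀ s ∈ S, T.IsOpenElem s) → S.Nonempty → DirectedOn (· ≤ ·) S →
      sSup S ∈ F → ∃ s ∈ S, s ∈ F

/-- Compact elements. -/
def IsCompactElem (a : M) : Prop :=
  ∀ S : Set M, (∀ s ∈ S, T.IsOpenElem s) → a ≤ sSup S →
    ∃ t ⊆ S, t.Finite ∧ a ≤ sSup t

/-- The relation `a ◁ b`: there is a compact element between `a` and `b`. -/
def Triangle (a b : M) : Prop := ∃ k : M, T.IsCompactElem k ∧ a ≤ k ∧ k ≤ b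

/-- Locally compact MT-algebras. -/
def LocallyCompact : Prop :=
  ∀ u : M, T.IsOpenElem u → u = sSup {v : M | T.IsOpenElem v ∧ T.Triangle v u}

/-- The way-below relation in the frame of open elements. -/
def WayBelowOpen (a b : M) : Prop :=
  ∀ S : Set M, (∀ s ∈ S, T.IsOpenElem s) → b ≤ sSup S →
    ∃ t ⊆ S, t.Finite ∧ a ≤ sSup t

/-- Elements approximated from above by regular closed elements. -/
def GC (a : M) : Prop :=
  a = sInf {b : M | ∃ c : M, a ≤ T.box c ∧ b = T.dia (T.box c)}

/-- Hausdorff MT-algebras. -/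
def IsHausdorff : Prop :=
  ∀ a : M, ∃ S : Set M, (∀ b ∈ S, T.GC b) ∧ a = sSup S

/-- Regular MT-algebras. -/
def IsRegular : Prop :=
  T.IsT1 ∧ ∀ a : M, T.IsOpenElem a →
    a = sSup {b : M | T.IsOpenElem b ∧ T.dia b ≤ a}

end MTAlg

/-- The atom space of a complete Boolean algebra. -/
abbrev AtomSpace (M : Type*) [CompleteBooleanAlgebra M] : Type _ := {x : M // IsAtom x}

/-- The set of atoms below an element. -/
def eta {M : Type*} [CompleteBooleanAlgebra M] (a : M) : Set (AtomSpace M) :=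
  {x : AtomSpace M | x.1 ≤ a}

namespace MTAlg

variable {M : Type*} [CompleteBooleanAlgebra M] (T : MTAlg M)

/-- The topology on the atom space, generated by the images of open elements. -/
def atTop : TopologicalSpace (AtomSpace M) :=
  TopologicalSpace.generateFrom {U : Set (AtomSpace M) | ∃ u : M, T.IsOpenElem u ∧ U = eta u}

end MTAlg

namespace MTAlg

variable {M : Type*} [CompleteBooleanAlgebra M] {T : MTAlg M}

theorem box_mono {a b : M} (h : a ≤ b) : T.box a ≤ T.box b := by
  rw [← inf_eq_left, ← T.box_inf, inf_eq_left.2 h]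

theorem IsOpenElem.inf {a b : M} (ha : T.IsOpenElem a) (hb : T.IsOpenElem b) :
    T.IsOpenElem (a ⊓ b) := by
  unfold IsOpenElem at *
  rw [T.box_inf, ha, hb]

theorem isOpenElem_sSup {S : Set M} (hS : ∀ s ∈ S, T.IsOpenElem s) : T.IsOpenElem (sSup S) :=
  le_antisymm (T.box_le _) <| sSup_le fun s hs ↦
    (hS s hs).ge.trans (box_mono (le_sSup hs))

theorem IsClosedElem.isOpenElem_compl {a : M} (ha : T.IsClosedElem a) : T.IsOpenElem aᶜ := by
  unfold IsOpenElem
  rw [← compl_compl (T.box aᶜ)]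
  exact congrArg _ ha

theorem IsOpenElem.isClosedElem_compl {a : M} (ha : T.IsOpenElem a) : T.IsClosedElem aᶜ := by
  unfold IsClosedElem dia
  rw [compl_compl, ha]

theorem le_dia (a : M) : a ≤ T.dia a := le_compl_comm.1 (T.box_le _)

theorem dia_le {a c : M} (hc : T.IsClosedElem c) (h : a ≤ c) : T.dia a ≤ c := by
  rw [← hc]
  exact compl_le_compl (box_mono (compl_le_compl h))

theorem IsSaturatedElem.inf {a b : M} (ha : T.IsSaturatedElem a) (hb : T.IsSaturatedElem b) :
    T.IsSaturatedElem (a ⊓ b) := by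
  obtain ⟨S, hS, rfl⟩ := ha
  obtain ⟨S', hS', rfl⟩ := hb
  exact ⟨S ∪ S', fun s hs ↦ hs.elim (hS s) (hS' s), sInf_union.symm⟩

theorem WayBelowOpen.mono {a a' b b' : M} (h : T.WayBelowOpen a b) (ha : a' ≤ a) (hb : b ≤ b') :
    T.WayBelowOpen a' b' := fun S hS hle ↦ by
  obtain ⟨t, htS, ht, hat⟩ := h S hS (hb.trans hle)
  exact ⟨t, htS, ht, ha.trans hat⟩

theorem WayBelowOpen.le {a b : M} (hb : T.IsOpenElem b) (h : T.WayBelowOpen a b) : a ≤ b := by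
  obtain ⟨t, htS, _, hat⟩ := h {b} (by rintro _ rfl; exact hb) (by simp)
  exact hat.trans ((sSup_le_sSup htS).trans (by simp))

theorem wayBelowOpen_sSup {t : Set M} {b : M} (ht : t.Finite)
    (h : ∀ y ∈ t, T.WayBelowOpen y b) : T.WayBelowOpen (sSup t) b := fun S hS hle ↦ by
  have h' : ∀ y ∈ t, ∃ r ⊆ S, r.Finite ∧ y ≤ sSup r := fun y hy ↦ h y hy S hS hle
  choose! r hrS hr hyr using h'
  exact ⟨⋃ y ∈ t, r y, Set.iUnion₂_subset hrS, ht.biUnion hr, sSup_le fun y hy ↦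
    (hyr y hy).trans (sSup_le_sSup (Set.subset_biUnion_of_mem hy))⟩

theorem Triangle.wayBelowOpen {a b : M} (h : T.Triangle a b) : T.WayBelowOpen a b := by
  obtain ⟨k, hk, hak, hkb⟩ := h
  exact WayBelowOpen.mono hk hak hkb

theorem triangle_sSup {t : Set M} {b : M} (ht : t.Finite) (h : ∀ y ∈ t, T.Triangle y b) :
    T.Triangle (sSup t) b := by
  choose! k hk hyk hkb using h
  refine ⟨sSup (k '' t), wayBelowOpen_sSup (ht.image k) ?_, ?_, sSup_le ?_⟩
  · rintro _ ⟨y, hy, rfl⟩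
    exact WayBelowOpen.mono (hk y hy) le_rfl (le_sSup (Set.mem_image_of_mem k hy))
  · exact sSup_le fun y hy ↦ (hyk y hy).trans (le_sSup (Set.mem_image_of_mem k hy))
  · rintro _ ⟨y, hy, rfl⟩
    exact hkb y hy

/-- An element compactly contained in an open one is separated from it by a compact saturated
element, namely the saturation of a compact one. -/
theorem Triangle.exists_isSaturatedElem {a b : M} (hb : T.IsOpenElem b) (h : T.Triangle a b) :
    ∃ k, T.IsCompactElem k ∧ T.IsSaturatedElem k ∧ a ≤ k ∧ k ≤ b := by
  obtain ⟨k, hk, hak, hkb⟩ := h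
  have hle : k ≤ sInf {u | T.IsOpenElem u ∧ k ≤ u} := le_sInf fun u hu ↦ hu.2
  refine ⟨sInf {u | T.IsOpenElem u ∧ k ≤ u}, fun S hS hkS ↦ ?_, ⟨_, fun u hu ↦ hu.1, rfl⟩,
    hak.trans hle, sInf_le ⟨hb, hkb⟩⟩
  obtain ⟨t, htS, ht, hkt⟩ := hk S hS (hle.trans hkS)
  exact ⟨t, htS, ht, sInf_le ⟨isOpenElem_sSup fun s hs ↦ hS s (htS hs), hkt⟩⟩

/-- In a locally compact MT-algebra, way-below elements are separated by a compact element. -/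
theorem LocallyCompact.triangle (hT : T.LocallyCompact) {a b : M} (hb : T.IsOpenElem b)
    (h : T.WayBelowOpen a b) : T.Triangle a b := by
  obtain ⟨t, htS, ht, hat⟩ := h _ (fun _ hv ↦ hv.1) (hT b hb).le
  obtain ⟨k, hk, htk, hkb⟩ := triangle_sSup ht fun y hy ↦ (htS hy).2
  exact ⟨k, hk, hat.trans htk, hkb⟩

/-- The frame of open elements is continuous. -/
def ContinuousOpens (T : MTAlg M) : Prop :=
  ∀ a : M, T.IsOpenElem a → a = sSup {v : M | T.IsOpenElem v ∧ T.WayBelowOpen v a}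

/-- Way-below elements interpolate along joins of open elements. -/
theorem ContinuousOpens.exists_finite_wayBelowOpen (hT : T.ContinuousOpens) {a : M} {S : Set M}
    (hS : ∀ s ∈ S, T.IsOpenElem s) (h : T.WayBelowOpen a (sSup S)) :
    ∃ t ⊆ S, t.Finite ∧ T.WayBelowOpen a (sSup t) := by
  obtain ⟨t, htD, ht, hat⟩ := h {y | T.IsOpenElem y ∧ ∃ s ∈ S, T.WayBelowOpen y s}
    (fun _ hy ↦ hy.1) <| sSup_le fun s hs ↦ (hT s (hS s hs)).le.trans <|
      sSup_le_sSup fun y hy ↦ ⟨hy.1, s, hs, hy.2⟩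
  have h' : ∀ y ∈ t, ∃ s ∈ S, T.WayBelowOpen y s := fun y hy ↦ (htD hy).2
  choose! f hfS hf using h'
  refine ⟨f '' t, Set.image_subset_iff.2 hfS, ht.image f,
    (wayBelowOpen_sSup ht fun y hy ↦ ?_).mono hat le_rfl⟩
  exact (hf y hy).mono le_rfl (le_sSup (Set.mem_image_of_mem f hy))

theorem ContinuousOpens.exists_wayBelowOpen_of_isCompactElem (hT : T.ContinuousOpens) {k a : M}
    (ha : T.IsOpenElem a) (hk : T.IsCompactElem k) (hka : k ≤ a) :
    ∃ b, T.IsOpenElem b ∧ k ≤ b ∧ T.WayBelowOpen b a := by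
  obtain ⟨t, htS, ht, hkt⟩ := hk _ (fun _ hv ↦ hv.1) (hka.trans (hT a ha).le)
  exact ⟨sSup t, isOpenElem_sSup fun y hy ↦ (htS hy).1, hkt,
    wayBelowOpen_sSup ht fun y hy ↦ (htS hy).2⟩

/-- A Scott-open filter of the frame of open elements. -/
structure IsScottOpenFilterOfOpens (T : MTAlg M) (F : Set M) : Prop where
  isOpenElem : ∀ w ∈ F, T.IsOpenElem w
  top_mem : ⊤ ∈ F
  mem_of_le : ∀ w ∈ F, ∀ u, T.IsOpenElem u → w ≤ u → u ∈ F
  inf_mem : ∀ w ∈ F, ∀ u ∈ F, w ⊓ u ∈ F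
  exists_finite : ∀ S : Set M, (∀ s ∈ S, T.IsOpenElem s) → sSup S ∈ F →
    ∃ t ⊆ S, t.Finite ∧ sSup t ∈ F

theorem IsScottOpenFilterOfOpens.exists_maximal {F : Set M} (hF : T.IsScottOpenFilterOfOpens F)
    {u : M} (hu : T.IsOpenElem u) (huF : u ∉ F) :
    ∃ p, u ≤ p ∧ Maximal (fun w ↦ T.IsOpenElem w ∧ w ∉ F) p := by
  refine zorn_le_nonempty₀ {w | T.IsOpenElem w ∧ w ∉ F} (fun C hC hchain y hy ↦ ?_) u ⟨hu, huF⟩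
  refine ⟨sSup C, ⟨isOpenElem_sSup fun w hw ↦ (hC hw).1, fun hmem ↦ ?_⟩, fun w hw ↦ le_sSup hw⟩
  obtain ⟨t, htC, ht, htF⟩ := hF.exists_finite C (fun w hw ↦ (hC hw).1) hmem
  obtain ⟨c, hcC, hc⟩ : ∃ c ∈ C, ∀ w ∈ t, w ≤ c := by
    clear htF
    induction t, ht using Set.Finite.induction_on with
    | empty => exact ⟨y, hy, by simp⟩
    | @insert a s _ _ ih =>
      obtain ⟨c, hcC, hc⟩ := ih ((Set.subset_insert a s).trans htC)
      have haC : a ∈ C := htC (Set.mem_insert a s)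
      rcases hchain.total haC hcC with h | h
      · exact ⟨c, hcC, fun w hw ↦ hw.elim (fun e ↦ e ▸ h) (hc w)⟩
      · exact ⟨a, haC, fun w hw ↦ hw.elim (fun e ↦ e.le) fun hw ↦ (hc w hw).trans h⟩
  exact (hC hcC).2 (hF.mem_of_le _ htF c (hC hcC).1 (sSup_le hc))

/-- A maximal open element outside a Scott-open filter has join-irreducible complement. -/
theorem IsScottOpenFilterOfOpens.joinIrredClosed_compl {F : Set M}
    (hF : T.IsScottOpenFilterOfOpens F) {p : M}
    (hp : Maximal (fun w ↦ T.IsOpenElem w ∧ w ∉ F) p) : T.JoinIrredClosed pᶜ := by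
  refine ⟨hp.prop.1.isClosedElem_compl, fun h ↦ ?_, fun a b ha hb hab ↦ ?_⟩
  · exact hp.prop.2 (compl_eq_bot.1 h ▸ hF.top_mem)
  · have key : ∀ c : M, T.IsClosedElem c → c ≤ pᶜ → pᶜ ≠ c → cᶜ ∈ F := fun c hc hle hne ↦ by
      by_contra hcF
      exact hne (le_antisymm (compl_le_iff_compl_le.1
        (hp.le_of_ge ⟨hc.isOpenElem_compl, hcF⟩ (le_compl_comm.1 hle))) hle)
    by_contra! hne
    apply hp.prop.2
    have hmem := hF.inf_mem _ (key a ha (hab ▸ le_sup_left) hne.1) _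
      (key b hb (hab ▸ le_sup_right) hne.2)
    rwa [← compl_sup, ← hab, compl_compl] at hmem

/-- The Hofmann–Mislove argument: in a sober MT-algebra, a Scott-open filter of open elements
contains every open element above its meet. -/
theorem IsScottOpenFilterOfOpens.mem_of_sInf_le {F : Set M} (hF : T.IsScottOpenFilterOfOpens F)
    (hsob : T.Sober) {u : M} (hu : T.IsOpenElem u) (hle : sInf F ≤ u) : u ∈ F := by
  by_contra huF
  obtain ⟨p, hup, hp⟩ := hF.exists_maximal hu huF
  obtain ⟨x, hx, hpx⟩ := hsob.2 _ (hF.joinIrredClosed_compl hp)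
  have hxp : x ≤ pᶜ := hpx ▸ le_dia x
  have hxF : x ≤ sInf F := le_sInf fun w hw ↦ by
    by_contra hxw
    have hxc : x ≤ wᶜ := le_compl_iff_disjoint_right.2 (hx.not_le_iff_disjoint.1 hxw)
    have hwp : w ≤ p :=
      compl_le_compl_iff_le.1 (hpx ▸ dia_le (hF.isOpenElem w hw).isClosedElem_compl hxc)
    exact hp.prop.2 (hF.mem_of_le w hw p hp.prop.1 hwp)
  exact hx.1 (le_bot_iff.1 ((le_inf (hxF.trans (hle.trans hup)) hxp).trans inf_compl_eq_bot.le))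

theorem IsScottOpenFilterOfOpens.isCompactElem_sInf {F : Set M}
    (hF : T.IsScottOpenFilterOfOpens F) (hsob : T.Sober) : T.IsCompactElem (sInf F) :=
  fun S hS hle ↦ by
    obtain ⟨t, htS, ht, htF⟩ :=
      hF.exists_finite S hS (hF.mem_of_sInf_le hsob (isOpenElem_sSup hS) hle)
    exact ⟨t, htS, ht, sInf_le htF⟩

/-- The way-below relation on open elements is stable under binary meets on the right. -/
def StableOpens (T : MTAlg M) : Prop :=
  ∀ a b c : M, T.IsOpenElem a → T.IsOpenElem b → T.IsOpenElem c →
    T.WayBelowOpen a b → T.WayBelowOpen a c → T.WayBelowOpen a (b ⊓ c)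

theorem isScottOpenFilterOfOpens_wayBelowOpen (hT : T.ContinuousOpens) (hst : T.StableOpens)
    {v u : M} (hv : T.IsOpenElem v) (h : T.WayBelowOpen v u) :
    T.IsScottOpenFilterOfOpens {w | T.IsOpenElem w ∧ T.WayBelowOpen v w} where
  isOpenElem _ hw := hw.1
  top_mem := ⟨T.box_top, h.mono le_rfl le_top⟩
  mem_of_le _ hw _ hu hle := ⟨hu, hw.2.mono le_rfl hle⟩
  inf_mem _ hw _ hu := ⟨hw.1.inf hu.1, hst _ _ _ hv hw.1 hu.1 hw.2 hu.2⟩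
  exists_finite S hS hmem := by
    obtain ⟨t, htS, ht, hvt⟩ := hT.exists_finite_wayBelowOpen hS hmem.2
    exact ⟨t, htS, ht, isOpenElem_sSup fun s hs ↦ hS s (htS hs), hvt⟩

theorem ContinuousOpens.locallyCompact (hT : T.ContinuousOpens) (hst : T.StableOpens)
    (hsob : T.Sober) : T.LocallyCompact := fun u hu ↦
  le_antisymm ((hT u hu).le.trans (sSup_le_sSup fun _ hv ↦ ⟨hv.1, _,
      (isScottOpenFilterOfOpens_wayBelowOpen hT hst hv.1 hv.2).isCompactElem_sInf hsob,
      le_sInf fun _ hw ↦ hw.2.le hw.1, sInf_le ⟨hu, hv.2⟩⟩))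
    (sSup_le fun _ ⟨_, _, _, hvk, hku⟩ ↦ hvk.trans hku)

/-- For compact `k` and `m`, the meets of an open element above `k` and one above `m` generate a
Scott-open filter. -/
theorem isScottOpenFilterOfOpens_inf (hT : T.ContinuousOpens) (hst : T.StableOpens)
    {k m : M} (hk : T.IsCompactElem k) (hm : T.IsCompactElem m) :
    T.IsScottOpenFilterOfOpens {w | T.IsOpenElem w ∧
      ∃ a b, T.IsOpenElem a ∧ T.IsOpenElem b ∧ k ≤ a ∧ m ≤ b ∧ a ⊓ b ≤ w} where
  isOpenElem _ hw := hw.1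
  top_mem := ⟨T.box_top, ⊤, ⊤, T.box_top, T.box_top, le_top, le_top, le_top⟩
  mem_of_le := by
    rintro w ⟨_, a, b, ha, hb, hka, hmb, hab⟩ u hu hle
    exact ⟨hu, a, b, ha, hb, hka, hmb, hab.trans hle⟩
  inf_mem := by
    rintro w ⟨hw, a, b, ha, hb, hka, hmb, hab⟩ u ⟨hu, c, d, hc, hd, hkc, hmd, hcd⟩
    refine ⟨hw.inf hu, a ⊓ c, b ⊓ d, ha.inf hc, hb.inf hd, le_inf hka hkc, le_inf hmb hmd, ?_⟩
    rw [inf_inf_inf_comm]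
    exact inf_le_inf hab hcd
  exists_finite := by
    rintro S hS ⟨_, a, b, ha, hb, hka, hmb, hab⟩
    obtain ⟨a', ha', hka', haa⟩ := hT.exists_wayBelowOpen_of_isCompactElem ha hk hka
    obtain ⟨b', hb', hmb', hbb⟩ := hT.exists_wayBelowOpen_of_isCompactElem hb hm hmb
    obtain ⟨t, htS, ht, hle⟩ := hst (a' ⊓ b') a b (ha'.inf hb') ha hb
      (haa.mono inf_le_left le_rfl) (hbb.mono inf_le_right le_rfl) S hS hab
    exact ⟨t, htS, ht, isOpenElem_sSup fun s hs ↦ hS s (htS hs), a', b', ha', hb', hka', hmb',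
      hle⟩

theorem ContinuousOpens.isCompactElem_inf (hT : T.ContinuousOpens) (hst : T.StableOpens)
    (hsob : T.Sober) {k m : M} (hk : T.IsCompactElem k) (hks : T.IsSaturatedElem k)
    (hm : T.IsCompactElem m) (hms : T.IsSaturatedElem m) : T.IsCompactElem (k ⊓ m) := by
  have hF := (isScottOpenFilterOfOpens_inf hT hst hk hm).isCompactElem_sInf hsob
  convert hF using 1
  refine le_antisymm (le_sInf ?_) (le_inf ?_ ?_)
  · rintro w ⟨_, a, b, _, _, hka, hmb, hab⟩
    exact (inf_le_inf hka hmb).trans hab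
  · obtain ⟨S, hS, rfl⟩ := hks
    exact le_sInf fun s hs ↦ sInf_le
      ⟨hS s hs, s, ⊤, hS s hs, T.box_top, sInf_le hs, le_top, inf_le_left⟩
  · obtain ⟨S, hS, rfl⟩ := hms
    exact le_sInf fun s hs ↦ sInf_le
      ⟨hS s hs, ⊤, s, T.box_top, hS s hs, le_top, sInf_le hs, inf_le_right⟩

end MTAlg

/-- A sober MT-algebra is stably locally compact iff its frame of open elements is a
stably continuous frame. -/
theorem stablyLocallyCompact_iff_stablyContinuous {M : Type*} [CompleteBooleanAlgebra M]
    (T : MTAlg M) (hsob : T.Sober) :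
    (T.LocallyCompact ∧
      ∀ k m : M, T.IsCompactElem k → T.IsSaturatedElem k →
        T.IsCompactElem m → T.IsSaturatedElem m →
          T.IsCompactElem (k ⊓ m) ∧ T.IsSaturatedElem (k ⊓ m)) ↔
    ((∀ a : M, T.IsOpenElem a →
        a = sSup {v : M | T.IsOpenElem v ∧ T.WayBelowOpen v a}) ∧
      ∀ a b c : M, T.IsOpenElem a → T.IsOpenElem b → T.IsOpenElem c →
        T.WayBelowOpen a b → T.WayBelowOpen a c → T.WayBelowOpen a (b ⊓ c)) := by
  constructor
  · rintro ⟨hlc, hinf⟩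
    refine ⟨fun a ha ↦ ?_, fun a b c _ hb hc hab hac ↦ ?_⟩
    · exact le_antisymm ((hlc a ha).le.trans
        (sSup_le_sSup fun v hv ↦ ⟨hv.1, hv.2.wayBelowOpen⟩)) (sSup_le fun v hv ↦ hv.2.le ha)
    · obtain ⟨k, hk, hks, hak, hkb⟩ := (hlc.triangle hb hab).exists_isSaturatedElem hb
      obtain ⟨m, hm, hms, ham, hmc⟩ := (hlc.triangle hc hac).exists_isSaturatedElem hc
      exact MTAlg.Triangle.wayBelowOpen
        ⟨k ⊓ m, (hinf k m hk hks hm hms).1, le_inf hak ham, inf_le_inf hkb hmc⟩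
  · rintro ⟨hcont, hst⟩
    have hT : T.ContinuousOpens := hcont
    exact ⟨hT.locallyCompact hst hsob, fun k m hk hks hm hms ↦
      ⟨hT.isCompactElem_inf hst hsob hk hks hm hms, hks.inf hms⟩⟩
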